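/- Let L(λ) := M_{τ_1}(Y_1) M_{σ_1}(X_1) (λ M_τ^P − M_σ^P) M_{σ_2}(X_2) M_{τ_2}(Y_2) =: λL_1 − L_0 be an EGFP of P(λ) such that m−1 and m do not simultaneously belong to σ, and −1 and −0 do not simultaneously belong to τ. Then L(λ) is operation free: every n×n block of L_1 and of L_0 is one of 0, ±I_n, ±A_j, ±A_j^{−1} for some 0 ≤ j ≤ m, or (up to sign) one of the matrices occurring in the matrix assignments X_1, X_2, Y_1, Y_2. -/

import Mathlib

open Matrix Polynomial

/-- Signed indices: `pos k` denotes `k` and `neg k` denotes `−k`, with `−0` and `0` distinct. -/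
inductive SIdx : Type where
  | pos : ℕ → SIdx
  | neg : ℕ → SIdx
deriving DecidableEq

namespace SIdx

/-- The absolute value of a signed index. -/
def val : SIdx → ℕ
  | pos k => k
  | neg k => k

/-- Whether a signed index is negative. -/
def isNeg : SIdx → Bool
  | pos _ => false
  | neg _ => true

/-- The successor `t + 1` of a signed index (`−s + 1 = −(s−1)`). -/
def succ : SIdx → SIdx
  | pos k => pos (k + 1)
  | neg 0 => pos 0
  | neg (k + 1) => neg k

/-- Negation of a signed index. -/
def negate : SIdx → SIdx
  | pos k => neg k
  | neg k => pos k

end SIdx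

/-- The ascending chain `(t, t+1, …, t+p)`. -/
def chainUp (t : SIdx) : ℕ → List SIdx
  | 0 => [t]
  | p + 1 => t :: chainUp t.succ p

/-- The number of consecutions `c_t(α)` of the index tuple `α` at `t` (`−1` when `t ∉ α`):
the largest `p` such that `(t, t+1, …, t+p)` is a subtuple (sublist) of `α`. -/
noncomputable def consAt (α : List SIdx) (t : SIdx) : ℤ :=
  letI := Classical.decPred (fun p : ℕ => (chainUp t p).Sublist α)
  if t ∈ α then (Nat.findGreatest (fun p : ℕ => (chainUp t p).Sublist α) α.length : ℤ) else -1

/-- The number of inversions `i_t(α)` of the index tuple `α` at `t` (`−1` when `t ∉ α`):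
the largest `q` such that `(t+q, …, t+1, t)` is a subtuple (sublist) of `α`. -/
noncomputable def invsAt (α : List SIdx) (t : SIdx) : ℤ :=
  letI := Classical.decPred (fun p : ℕ => ((chainUp t p).reverse).Sublist α)
  if t ∈ α then (Nat.findGreatest (fun p : ℕ => ((chainUp t p).reverse).Sublist α) α.length : ℤ)
  else -1

/-- The Successor Infix Property: between any two equal entries there is an occurrence of
their successor. -/
def SIP (α : List SIdx) : Prop :=
  ∀ a b : Fin α.length, a < b → α.get a = α.get b →
    ∃ c : Fin α.length, a < c ∧ c < b ∧ α.get c = (α.get a).succ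

/-- The `mn × mn` elementary matrix `M_k(X)` (viewed as an `m × m` block matrix with
`n × n` blocks): `M_0(X) = M_{−0}(X) = diag(I_{(m−1)n}, X)`,
`M_m(X) = M_{−m}(X) = diag(X, I_{(m−1)n})`, and for `1 ≤ i ≤ m−1` the matrix `M_i(X)`
(resp. `M_{−i}(X)`) is the identity except for the 2×2 block submatrix
`[[X, I],[I, 0]]` (resp. `[[0, I],[I, X]]`) in block rows/columns `(m−i, m−i+1)`
(1-indexed). -/
noncomputable def elemMat (m n : ℕ) (k : SIdx) (X : Matrix (Fin n) (Fin n) ℂ) :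
    Matrix (Fin m × Fin n) (Fin m × Fin n) ℂ := fun p q =>
  if k.val = 0 then
    if p.1 = q.1 then (if (p.1 : ℕ) = m - 1 then X p.2 q.2 else if p.2 = q.2 then 1 else 0)
    else 0
  else if k.val = m then
    if p.1 = q.1 then (if (p.1 : ℕ) = 0 then X p.2 q.2 else if p.2 = q.2 then 1 else 0)
    else 0
  else
    if (p.1 : ℕ) = m - k.val - 1 ∧ (q.1 : ℕ) = m - k.val - 1 then
      (if k.isNeg then 0 else X p.2 q.2)
    else if ((p.1 : ℕ) = m - k.val - 1 ∧ (q.1 : ℕ) = m - k.val) ∨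
        ((p.1 : ℕ) = m - k.val ∧ (q.1 : ℕ) = m - k.val - 1) then
      (if p.2 = q.2 then 1 else 0)
    else if (p.1 : ℕ) = m - k.val ∧ (q.1 : ℕ) = m - k.val then
      (if k.isNeg then X p.2 q.2 else 0)
    else if p = q then 1 else 0

/-- `M_t(X) = M_{t_1}(X_1) ⋯ M_{t_r}(X_r)` for an index tuple `t` with matrix assignment `Xs`. -/
noncomputable def prodAssign (m n : ℕ) (t : List SIdx) (Xs : List (Matrix (Fin n) (Fin n) ℂ)) :
    Matrix (Fin m × Fin n) (Fin m × Fin n) ℂ :=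
  ((t.zip Xs).map fun p => elemMat m n p.1 p.2).prod

/-- The trivial (Fiedler) matrix assignment of `P(λ) = Σ λ^i A_i`:
`M_i^P = M_i(−A_i)` for `0 ≤ i ≤ m−1`, `M_m^P = (M_{−m}^P)⁻¹ = M_m(A_m⁻¹)`,
`M_{−i}^P = M_{−i}(A_i)` for `1 ≤ i ≤ m`, and `M_{−0}^P = (M_0^P)⁻¹ = M_{−0}((−A_0)⁻¹)`. -/
noncomputable def fiedlerX (m : ℕ) {n : ℕ} (A : ℕ → Matrix (Fin n) (Fin n) ℂ) :
    SIdx → Matrix (Fin n) (Fin n) ℂ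
  | .pos i => if i = m then (A m)⁻¹ else -A i
  | .neg i => if i = 0 then (-A 0)⁻¹ else A i

/-- `M_t^P`, the product of Fiedler matrices of `P` along the index tuple `t`. -/
noncomputable def prodFiedler (m n : ℕ) (A : ℕ → Matrix (Fin n) (Fin n) ℂ) (t : List SIdx) :
    Matrix (Fin m × Fin n) (Fin m × Fin n) ℂ :=
  (t.map fun k => elemMat m n k (fiedlerX m A k)).prod

/-- A nonsingular matrix assignment: the matrices assigned to positions with indices
`±0` or `±m` are nonsingular. -/
def NonsingAssign (m : ℕ) {n : ℕ} (t : List SIdx) (Xs : List (Matrix (Fin n) (Fin n) ℂ)) :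
    Prop :=
  t.length = Xs.length ∧ ∀ p ∈ t.zip Xs, (p.1.val = 0 ∨ p.1.val = m) → IsUnit p.2

/-- The data of an extended generalized Fiedler pencil (EGFP)
`L(λ) = M_{τ₁}(Y₁) M_{σ₁}(X₁) (λ M_τ^P − M_σ^P) M_{σ₂}(X₂) M_{τ₂}(Y₂)`
of the `n × n` matrix polynomial `P(λ) = Σ_{i=0}^m λ^i A_i` of degree `m ≥ 2`. -/
structure EGFPData (m n : ℕ) where
  /-- coefficients of `P` -/
  A : ℕ → Matrix (Fin n) (Fin n) ℂ
  sig : List SIdx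
  tau : List SIdx
  sig1 : List SIdx
  sig2 : List SIdx
  tau1 : List SIdx
  tau2 : List SIdx
  X1 : List (Matrix (Fin n) (Fin n) ℂ)
  X2 : List (Matrix (Fin n) (Fin n) ℂ)
  Y1 : List (Matrix (Fin n) (Fin n) ℂ)
  Y2 : List (Matrix (Fin n) (Fin n) ℂ)
  hm : 2 ≤ m
  hAm : A m ≠ 0
  hsigpos : ∀ k ∈ sig, k.isNeg = false
  htauneg : ∀ k ∈ tau, k.isNeg = true
  /-- `(σ, ω)` is a permutation of `{0, 1, …, m}`, where `τ = −ω`. -/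
  hperm : List.Perm (sig.map SIdx.val ++ tau.map SIdx.val) (List.range (m + 1))
  hsig1 : ∀ k ∈ sig1, k ∈ sig ∧ k.val + 2 ≤ m
  hsig2 : ∀ k ∈ sig2, k ∈ sig ∧ k.val + 2 ≤ m
  htau1 : ∀ k ∈ tau1, k ∈ tau ∧ 2 ≤ k.val
  htau2 : ∀ k ∈ tau2, k ∈ tau ∧ 2 ≤ k.val
  hSIPsig : SIP (sig1 ++ sig ++ sig2)
  hSIPtau : SIP (tau1 ++ tau ++ tau2)
  hX1 : NonsingAssign m sig1 X1
  hX2 : NonsingAssign m sig2 X2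
  hY1 : NonsingAssign m tau1 Y1
  hY2 : NonsingAssign m tau2 Y2
  hA0 : SIdx.neg 0 ∈ tau → IsUnit (A 0)
  hAmUnit : SIdx.pos m ∈ sig → IsUnit (A m)

namespace EGFPData

variable {m n : ℕ}

/-- `M_{τ₁}(Y₁) M_{σ₁}(X₁)`. -/
noncomputable def leftFac (E : EGFPData m n) : Matrix (Fin m × Fin n) (Fin m × Fin n) ℂ :=
  prodAssign m n E.tau1 E.Y1 * prodAssign m n E.sig1 E.X1

/-- `M_{σ₂}(X₂) M_{τ₂}(Y₂)`. -/
noncomputable def rightFac (E : EGFPData m n) : Matrix (Fin m × Fin n) (Fin m × Fin n) ℂ :=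
  prodAssign m n E.sig2 E.X2 * prodAssign m n E.tau2 E.Y2

/-- The coefficient `L₁` of `λ` in `L(λ) = λ L₁ − L₀`. -/
noncomputable def L1 (E : EGFPData m n) : Matrix (Fin m × Fin n) (Fin m × Fin n) ℂ :=
  E.leftFac * prodFiedler m n E.A E.tau * E.rightFac

/-- The constant term `L₀` in `L(λ) = λ L₁ − L₀`. -/
noncomputable def L0 (E : EGFPData m n) : Matrix (Fin m × Fin n) (Fin m × Fin n) ℂ :=
  E.leftFac * prodFiedler m n E.A E.sig * E.rightFac

end EGFPData

/-- The `(i, j)` block (of size `n × n`) of an `mn × mn` matrix. -/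
def blockOf {m n : ℕ} (M : Matrix (Fin m × Fin n) (Fin m × Fin n) ℂ) (i j : Fin m) :
    Matrix (Fin n) (Fin n) ℂ := fun p q => M (i, p) (j, q)

/-- Block penta-diagonal: all blocks `B_{ij}` with `|i − j| > 2` vanish. -/
def BlockPenta {m n : ℕ} (M : Matrix (Fin m × Fin n) (Fin m × Fin n) ℂ) : Prop :=
  ∀ i j : Fin m, ((i : ℕ) + 2 < (j : ℕ) ∨ (j : ℕ) + 2 < (i : ℕ)) → blockOf M i j = 0

/-- Block tridiagonal: all blocks `B_{ij}` with `|i − j| > 1` vanish. -/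
def BlockTri {m n : ℕ} (M : Matrix (Fin m × Fin n) (Fin m × Fin n) ℂ) : Prop :=
  ∀ i j : Fin m, ((i : ℕ) + 1 < (j : ℕ) ∨ (j : ℕ) + 1 < (i : ℕ)) → blockOf M i j = 0

/-- `e_j^T ⊗ I_n` as an `n × mn` matrix, for a 1-indexed block index `j`
(zero when `j` is out of range). -/
def rowSel (m n : ℕ) (j : ℤ) : Matrix (Fin n) (Fin m × Fin n) ℂ :=
  fun p q => if ((q.1 : ℕ) : ℤ) + 1 = j ∧ p = q.2 then 1 else 0

/-- `e_j ⊗ I_n` as an `mn × n` matrix, for a 1-indexed block index `j`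
(zero when `j` is out of range). -/
def colSel (m n : ℕ) (j : ℤ) : Matrix (Fin m × Fin n) (Fin n) ℂ :=
  fun p q => if ((p.1 : ℕ) : ℤ) + 1 = j ∧ p.2 = q then 1 else 0

/-- The matrix polynomial `P(λ) = Σ_{i=0}^m λ^i A_i` as an `n × n` matrix over `ℂ[λ]`. -/
noncomputable def polyP (m n : ℕ) (A : ℕ → Matrix (Fin n) (Fin n) ℂ) :
    Matrix (Fin n) (Fin n) (Polynomial ℂ) := fun p q =>
  ∑ i ∈ Finset.range (m + 1), Polynomial.C (A i p q) * Polynomial.X ^ i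

/-- An `n × n` block is "operation free" for the EGFP data `E`: it is one of
`0`, `±I_n`, `±A_j`, `±A_j⁻¹` (`0 ≤ j ≤ m`), or (up to sign) one of the matrices of the
assignments `X₁, X₂, Y₁, Y₂`. -/
def OpFreeBlock {m n : ℕ} (E : EGFPData m n) (B : Matrix (Fin n) (Fin n) ℂ) : Prop :=
  B = 0 ∨ B = 1 ∨ B = -1 ∨
  (∃ j ≤ m, B = E.A j ∨ B = -E.A j ∨ B = (E.A j)⁻¹ ∨ B = -(E.A j)⁻¹) ∨
  (∃ W ∈ E.X1 ++ E.X2 ++ E.Y1 ++ E.Y2, B = W ∨ B = -W)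

namespace EGFPProof

/-- selector of the block row with reversed coordinate `c` (block row `m - 1 - c`, 0-indexed) -/
def Esel (m n c : ℕ) : Matrix (Fin n) (Fin m × Fin n) ℂ :=
  fun a q => if (q.1 : ℕ) + c + 1 = m ∧ a = q.2 then 1 else 0

lemma Esel_mul {m n c : ℕ} (hc : c < m) (M : Matrix (Fin m × Fin n) (Fin m × Fin n) ℂ)
    (a : Fin n) (q : Fin m × Fin n) :
    (Esel m n c * M) a q = M (⟨m - 1 - c, by omega⟩, a) q := by
  rw [Matrix.mul_apply, Finset.sum_eq_single (⟨m - 1 - c, by omega⟩, a)]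
  · have : m - 1 - c + c + 1 = m := by omega
    simp [Esel, this]
  · rintro ⟨p, b⟩ - hne
    have : ¬ ((p : ℕ) + c + 1 = m ∧ a = b) := by
      rintro ⟨h1, rfl⟩
      apply hne
      ext
      · simp; omega
      · rfl
    simp [Esel, this]
  · simp

lemma mul_Esel {m n c : ℕ} (X : Matrix (Fin n) (Fin n) ℂ) (a : Fin n) (q : Fin m × Fin n) :
    (X * Esel m n c) a q = if (q.1 : ℕ) + c + 1 = m then X a q.2 else 0 := by
  rw [Matrix.mul_apply]
  by_cases h : (q.1 : ℕ) + c + 1 = m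
  · simp [Esel, h]
  · simp [Esel, h]

lemma Esel_big {m n c : ℕ} (hc : m ≤ c) : Esel m n c = 0 := by
  ext a q
  have : ¬ ((q.1 : ℕ) + c + 1 = m ∧ a = q.2) := by omega
  simp [Esel, this]

lemma Esel_Esel {m n c e : ℕ} (hc : c < m) :
    Esel m n c * (Esel m n e)ᵀ = if c = e then 1 else 0 := by
  ext a b
  rw [Matrix.mul_apply, Finset.sum_eq_single (⟨m - 1 - c, by omega⟩, a)]
  · have : m - 1 - c + c + 1 = m := by omega
    by_cases h : c = e
    · subst h
      simp [Esel, this, Matrix.one_apply, eq_comm]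
    · have h2 : ¬ (m - 1 - c + e + 1 = m) := by omega
      simp [Esel, this, h, h2]
  · rintro ⟨p, b⟩ - hne
    have : ¬ ((p : ℕ) + c + 1 = m ∧ a = b) := by
      rintro ⟨h1, rfl⟩
      apply hne
      ext
      · simp; omega
      · rfl
    simp [Esel, this]
  · simp

lemma row_other {m n : ℕ} (hm : 2 ≤ m) (k : SIdx) (hk : k.val ≤ m)
    (X : Matrix (Fin n) (Fin n) ℂ) {c : ℕ} (h1 : c ≠ k.val) (h2 : c + 1 ≠ k.val) :
    Esel m n c * elemMat m n k X = Esel m n c := by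
  by_cases hc : c < m
  · ext a ⟨q, b⟩
    rw [Esel_mul hc]
    unfold elemMat Esel
    simp only [Prod.mk.injEq, Fin.ext_iff]
    have := q.2
    grind
  · rw [Esel_big (by omega)]; simp

lemma row_zero {m n : ℕ} (hm : 2 ≤ m) (k : SIdx) (hk : k.val = 0)
    (X : Matrix (Fin n) (Fin n) ℂ) :
    Esel m n 0 * elemMat m n k X = X * Esel m n 0 := by
  ext a ⟨q, b⟩
  rw [Esel_mul (by omega), mul_Esel]
  unfold elemMat
  simp only [Fin.ext_iff]
  have := q.2
  grind

lemma row_m {m n : ℕ} (hm : 2 ≤ m) (k : SIdx) (hk : k.val = m)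
    (X : Matrix (Fin n) (Fin n) ℂ) :
    Esel m n (m - 1) * elemMat m n k X = X * Esel m n (m - 1) := by
  ext a ⟨q, b⟩
  rw [Esel_mul (by omega), mul_Esel]
  unfold elemMat
  simp only [Fin.ext_iff]
  have := q.2
  grind

lemma row_pos_up {m n k : ℕ} (h1 : k + 1 < m) (X : Matrix (Fin n) (Fin n) ℂ) :
    Esel m n (k + 1) * elemMat m n (.pos (k + 1)) X = X * Esel m n (k + 1) + Esel m n k := by
  ext a ⟨q, b⟩
  rw [Esel_mul h1, Matrix.add_apply, mul_Esel]
  simp only [elemMat, Esel, SIdx.val, SIdx.isNeg, Fin.ext_iff, Prod.mk.injEq]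
  have := q.2
  grind

lemma row_pos_low {m n k : ℕ} (h1 : k + 1 < m) (X : Matrix (Fin n) (Fin n) ℂ) :
    Esel m n k * elemMat m n (.pos (k + 1)) X = Esel m n (k + 1) := by
  ext a ⟨q, b⟩
  rw [Esel_mul (by omega)]
  simp only [elemMat, Esel, SIdx.val, SIdx.isNeg, Fin.ext_iff, Prod.mk.injEq]
  have := q.2
  grind

lemma row_neg_low {m n k : ℕ} (h1 : k + 1 < m) (X : Matrix (Fin n) (Fin n) ℂ) :
    Esel m n k * elemMat m n (.neg (k + 1)) X = X * Esel m n k + Esel m n (k + 1) := by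
  ext a ⟨q, b⟩
  rw [Esel_mul (by omega), Matrix.add_apply, mul_Esel]
  simp only [elemMat, Esel, SIdx.val, SIdx.isNeg, Fin.ext_iff, Prod.mk.injEq]
  have := q.2
  grind

lemma row_neg_up {m n k : ℕ} (h1 : k + 1 < m) (X : Matrix (Fin n) (Fin n) ℂ) :
    Esel m n (k + 1) * elemMat m n (.neg (k + 1)) X = Esel m n k := by
  ext a ⟨q, b⟩
  rw [Esel_mul h1]
  simp only [elemMat, Esel, SIdx.val, SIdx.isNeg, Fin.ext_iff, Prod.mk.injEq]
  have := q.2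
  grind

/-- product along a list of (index, matrix) pairs -/
noncomputable def P (m n : ℕ) (l : List (SIdx × Matrix (Fin n) (Fin n) ℂ)) :
    Matrix (Fin m × Fin n) (Fin m × Fin n) ℂ :=
  (l.map fun p => elemMat m n p.1 p.2).prod

lemma P_cons {m n : ℕ} (y : SIdx × Matrix (Fin n) (Fin n) ℂ) (l) :
    P m n (y :: l) = elemMat m n y.1 y.2 * P m n l := by simp [P]

/-- upward mode -/
def UM (m : ℕ) : List SIdx → ℕ → Prop
  | [], _ => True
  | .pos k :: l, c => c ≠ k ∧ if c + 1 = k then k ≠ m ∧ UM m l k else UM m l c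
  | .neg k :: l, c => c ≠ k ∧ c + 1 ≠ k ∧ UM m l c

/-- downward mode -/
def DM (m : ℕ) : List SIdx → ℕ → Prop
  | [], _ => True
  | .pos k :: l, c => c ≠ k ∧ c + 1 ≠ k ∧ DM m l c
  | .neg k :: l, c => c + 1 ≠ k ∧ if c = k then k ≠ 0 ∧ DM m l (k - 1) else DM m l c

lemma U_row {m n : ℕ} (hm : 2 ≤ m) (l : List (SIdx × Matrix (Fin n) (Fin n) ℂ)) :
    ∀ c, c < m → (∀ y ∈ l, y.1.val ≤ m) → UM m (l.map Prod.fst) c →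
    ∃ e < m, Esel m n c * P m n l = Esel m n e ∧
      ∀ c' < c, Esel m n c' * P m n l * (Esel m n e)ᵀ = 0 := by
  induction l with
  | nil =>
    intro c hc _ _
    refine ⟨c, hc, by simp [P], fun c' h => ?_⟩
    have : c' ≠ c := by omega
    simp [P, Esel_Esel (show c' < m by omega), this]
  | cons y l ih =>
    obtain ⟨k, X⟩ := y
    intro c hc hv hU
    have hv' : ∀ y ∈ l, y.1.val ≤ m := fun y hy => hv y (by simp [hy])
    have hkm : k.val ≤ m := hv (k, X) (by simp)
    rw [P_cons]
    simp only [← Matrix.mul_assoc]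
    cases k with
    | pos k =>
      simp only [List.map_cons, UM] at hU
      simp only [SIdx.val] at hkm
      obtain ⟨hck, hU⟩ := hU
      split_ifs at hU with h
      · subst h
        obtain ⟨e, he, h1, h2⟩ := ih (c + 1) (by omega) hv' hU.2
        refine ⟨e, he, ?_, fun c' hc' => ?_⟩
        · rw [row_pos_low (by omega), h1]
        · rw [row_other (c := c') hm (.pos _) hkm _ (by simp [SIdx.val]; omega) (by simp [SIdx.val]; omega)]
          exact h2 _ (by omega)
      · obtain ⟨e, he, h1, h2⟩ := ih c hc hv' hU
        refine ⟨e, he, ?_, fun c' hc' => ?_⟩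
        · rw [row_other (c := c) hm (.pos _) hkm _ (by simpa [SIdx.val]) (by simpa [SIdx.val]), h1]
        · by_cases g1 : c' = k
          · subst g1
            cases c' with
            | zero =>
              rw [row_zero hm _ rfl, Matrix.mul_assoc, Matrix.mul_assoc, ← Matrix.mul_assoc (Esel m n 0),
                h2 _ hc', Matrix.mul_zero]
            | succ j =>
              rw [row_pos_up (by omega), Matrix.add_mul, Matrix.add_mul, h2 j (by omega),
                Matrix.mul_assoc, Matrix.mul_assoc, ← Matrix.mul_assoc (Esel m n (j+1)),
                h2 _ hc', Matrix.mul_zero, add_zero]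
          · by_cases g2 : c' + 1 = k
            · subst g2
              rw [row_pos_low (by omega), h2 _ (by omega)]
            · rw [row_other (c := c') hm (.pos _) hkm _ (by simpa [SIdx.val]) (by simpa [SIdx.val])]
              exact h2 _ (by omega)
    | neg k =>
      simp only [List.map_cons, UM] at hU
      simp only [SIdx.val] at hkm
      obtain ⟨hck, hck', hU⟩ := hU
      obtain ⟨e, he, h1, h2⟩ := ih c hc hv' hU
      refine ⟨e, he, ?_, fun c' hc' => ?_⟩
      · rw [row_other (c := c) hm (.neg _) hkm _ (by simpa [SIdx.val]) (by simpa [SIdx.val]), h1]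
      · by_cases g1 : c' = k
        · subst g1
          cases c' with
          | zero =>
            rw [row_zero hm _ rfl, Matrix.mul_assoc, Matrix.mul_assoc, ← Matrix.mul_assoc (Esel m n 0),
              h2 _ hc', Matrix.mul_zero]
          | succ j =>
            rw [row_neg_up (by omega), h2 j (by omega)]
        · by_cases g2 : c' + 1 = k
          · subst g2
            rw [row_neg_low (by omega), Matrix.add_mul, Matrix.add_mul, h2 (c'+1) (by omega),
                Matrix.mul_assoc, Matrix.mul_assoc, ← Matrix.mul_assoc (Esel m n c'),
                h2 _ hc', Matrix.mul_zero, add_zero]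
          · rw [row_other (c := c') hm (.neg _) hkm _ (by simpa [SIdx.val]) (by simpa [SIdx.val])]
            exact h2 _ (by omega)

lemma D_row {m n : ℕ} (hm : 2 ≤ m) (l : List (SIdx × Matrix (Fin n) (Fin n) ℂ)) :
    ∀ c, c < m → (∀ y ∈ l, y.1.val ≤ m) → DM m (l.map Prod.fst) c →
    ∃ e < m, Esel m n c * P m n l = Esel m n e ∧
      ∀ c' < m, c < c' → Esel m n c' * P m n l * (Esel m n e)ᵀ = 0 := by
  induction l with
  | nil =>
    intro c hc _ _
    refine ⟨c, hc, by simp [P], fun c' h h' => ?_⟩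
    have : c' ≠ c := by omega
    simp [P, Esel_Esel (show c' < m by omega), this]
  | cons y l ih =>
    obtain ⟨k, X⟩ := y
    intro c hc hv hU
    have hv' : ∀ y ∈ l, y.1.val ≤ m := fun y hy => hv y (by simp [hy])
    have hkm : k.val ≤ m := hv (k, X) (by simp)
    rw [P_cons]
    simp only [← Matrix.mul_assoc]
    cases k with
    | neg k =>
      simp only [List.map_cons, DM] at hU
      simp only [SIdx.val] at hkm
      obtain ⟨hck, hU⟩ := hU
      split_ifs at hU with h
      · subst h
        obtain ⟨hc0, hU⟩ := hU
        obtain ⟨d, rfl⟩ : ∃ d, c = d + 1 := ⟨c - 1, by omega⟩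
        simp only [Nat.add_sub_cancel] at hU
        obtain ⟨e, he, h1, h2⟩ := ih d (by omega) hv' hU
        refine ⟨e, he, ?_, fun c' hcm hc' => ?_⟩
        · rw [row_neg_up (by omega), h1]
        · rw [row_other (c := c') hm (.neg _) hkm _ (by simp [SIdx.val]; omega) (by simp [SIdx.val]; omega)]
          exact h2 _ hcm (by omega)
      · obtain ⟨e, he, h1, h2⟩ := ih c hc hv' hU
        refine ⟨e, he, ?_, fun c' hcm hc' => ?_⟩
        · rw [row_other (c := c) hm (.neg _) hkm _ (by simpa [SIdx.val]) (by simpa [SIdx.val]), h1]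
        · by_cases g1 : c' = k
          · subst g1
            obtain ⟨d, rfl⟩ : ∃ d, c' = d + 1 := ⟨c' - 1, by omega⟩
            rw [row_neg_up (by omega), h2 d (by omega) (by omega)]
          · by_cases g2 : c' + 1 = k
            · subst g2
              by_cases g3 : c' + 1 = m
              · obtain rfl : c' = m - 1 := by omega
                rw [row_m hm _ (by simp [SIdx.val, g3]), Matrix.mul_assoc, Matrix.mul_assoc, ← Matrix.mul_assoc (Esel m n _),
                  h2 _ hcm hc', Matrix.mul_zero]
              · rw [row_neg_low (by omega), Matrix.add_mul, Matrix.add_mul,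
                  h2 (c'+1) (by omega) (by omega),
                  Matrix.mul_assoc, Matrix.mul_assoc, ← Matrix.mul_assoc (Esel m n c'),
                  h2 _ hcm hc', Matrix.mul_zero, add_zero]
            · rw [row_other (c := c') hm (.neg _) hkm _ (by simpa [SIdx.val]) (by simpa [SIdx.val])]
              exact h2 _ hcm (by omega)
    | pos k =>
      simp only [List.map_cons, DM] at hU
      simp only [SIdx.val] at hkm
      obtain ⟨hck, hck', hU⟩ := hU
      obtain ⟨e, he, h1, h2⟩ := ih c hc hv' hU
      refine ⟨e, he, ?_, fun c' hcm hc' => ?_⟩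
      · rw [row_other (c := c) hm (.pos _) hkm _ (by simpa [SIdx.val]) (by simpa [SIdx.val]), h1]
      · by_cases g1 : c' = k
        · subst g1
          obtain ⟨d, rfl⟩ : ∃ d, c' = d + 1 := ⟨c' - 1, by omega⟩
          rw [row_pos_up (by omega), Matrix.add_mul, Matrix.add_mul, h2 d (by omega) (by omega),
                Matrix.mul_assoc, Matrix.mul_assoc, ← Matrix.mul_assoc (Esel m n (d+1)),
                h2 _ hcm hc', Matrix.mul_zero, add_zero]
        · by_cases g2 : c' + 1 = k
          · subst g2
            by_cases g3 : c' + 1 = m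
            · obtain rfl : c' = m - 1 := by omega
              rw [row_m hm _ (by simp [SIdx.val, g3]), Matrix.mul_assoc, Matrix.mul_assoc, ← Matrix.mul_assoc (Esel m n _),
                  h2 _ hcm hc', Matrix.mul_zero]
            · rw [row_pos_low (by omega), h2 _ (by omega) (by omega)]
          · rw [row_other (c := c') hm (.pos _) hkm _ (by simpa [SIdx.val]) (by simpa [SIdx.val])]
            exact h2 _ hcm (by omega)

/-- condition after using the weight of an index -/
def After (m : ℕ) : SIdx → List SIdx → Prop
  | .pos k, l => if k = m then DM m l (m - 1) else UM m l k
  | .neg k, l => if k = 0 then UM m l 0 else DM m l (k - 1)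

/-- every use of a weight is followed by weightless steps only -/
def AllGood (m : ℕ) : List SIdx → Prop
  | [] => True
  | k :: l => After m k l ∧ AllGood m l

lemma weight_blk {m n c e e0 : ℕ} (X : Matrix (Fin n) (Fin n) ℂ)
    (Q : Matrix (Fin m × Fin n) (Fin m × Fin n) ℂ)
    (he0 : e0 < m) (h : Esel m n c * Q = Esel m n e0) :
    X * Esel m n c * Q * (Esel m n e)ᵀ = if e0 = e then X else 0 := by
  rw [Matrix.mul_assoc X, h, Matrix.mul_assoc, Esel_Esel he0]
  split_ifs <;> simp

lemma main_blk {m n : ℕ} (hm : 2 ≤ m) (l : List (SIdx × Matrix (Fin n) (Fin n) ℂ)) :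
    (∀ y ∈ l, y.1.val ≤ m) → AllGood m (l.map Prod.fst) →
    ∀ c e, c < m → e < m →
      Esel m n c * P m n l * (Esel m n e)ᵀ = 0 ∨ Esel m n c * P m n l * (Esel m n e)ᵀ = 1 ∨
      ∃ y ∈ l, Esel m n c * P m n l * (Esel m n e)ᵀ = y.2 := by
  induction l with
  | nil =>
    intro _ _ c e hc he
    simp only [P, List.map_nil, List.prod_nil, Matrix.mul_one, Esel_Esel hc]
    split_ifs <;> simp
  | cons y l ih =>
    obtain ⟨k, X⟩ := y
    intro hv hG c e hc he
    have hv' : ∀ y ∈ l, y.1.val ≤ m := fun y hy => hv y (by simp [hy])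
    have hkm : k.val ≤ m := hv (k, X) (by simp)
    obtain ⟨hA, hG⟩ := hG
    have ih' : ∀ c, c < m → 
      Esel m n c * P m n l * (Esel m n e)ᵀ = 0 ∨ Esel m n c * P m n l * (Esel m n e)ᵀ = 1 ∨
      ∃ y ∈ (k, X) :: l, Esel m n c * P m n l * (Esel m n e)ᵀ = y.2 := by
      intro c hc
      rcases ih hv' hG c e hc he with h | h | ⟨y, hy, h⟩
      · exact Or.inl h
      · exact Or.inr (Or.inl h)
      · exact Or.inr (Or.inr ⟨y, by simp [hy], h⟩)
    have wt : ∀ B : Matrix (Fin n) (Fin n) ℂ, B = X → B = 0 ∨ B = 1 ∨ ∃ y ∈ (k, X) :: l, B = y.2 :=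
      fun B hB => Or.inr (Or.inr ⟨(k, X), by simp, hB⟩)
    rw [P_cons]
    simp only [← Matrix.mul_assoc]
    by_cases g1 : c ≠ k.val ∧ c + 1 ≠ k.val
    · rw [row_other hm k hkm X g1.1 g1.2]
      exact ih' c hc
    cases k with
    | pos k =>
      simp only [SIdx.val] at g1 hkm
      simp only [After] at hA
      by_cases hk : k = m
      · subst hk
        rw [if_pos rfl] at hA
        obtain rfl : c = k - 1 := by omega
        obtain ⟨e0, he0, h1, h2⟩ := D_row hm l (k - 1) hc hv' hA
        rw [row_m hm _ rfl, weight_blk _ _ he0 h1]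
        split_ifs
        · exact wt _ rfl
        · exact Or.inl rfl
      · rw [if_neg hk] at hA
        obtain ⟨e0, he0, h1, h2⟩ := U_row hm l k (by omega) hv' hA
        by_cases hck : c = k
        · subst hck
          cases c with
          | zero =>
            rw [row_zero hm _ rfl, weight_blk _ _ he0 h1]
            split_ifs
            · exact wt _ rfl
            · exact Or.inl rfl
          | succ d =>
            rw [row_pos_up hc, Matrix.add_mul, Matrix.add_mul, weight_blk _ _ he0 h1]
            split_ifs with h
            · subst h
              rw [h2 d (by omega), add_zero]
              exact wt _ rfl
            · rw [zero_add]
              exact ih' d (by omega)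
        · obtain rfl : k = c + 1 := by omega
          rw [row_pos_low (by omega)]
          exact ih' _ (by omega)
    | neg k =>
      simp only [SIdx.val] at g1 hkm
      simp only [After] at hA
      by_cases hk : k = 0
      · subst hk
        rw [if_pos rfl] at hA
        obtain rfl : c = 0 := by omega
        obtain ⟨e0, he0, h1, h2⟩ := U_row hm l 0 hc hv' hA
        rw [row_zero hm _ rfl, weight_blk _ _ he0 h1]
        split_ifs
        · exact wt _ rfl
        · exact Or.inl rfl
      · rw [if_neg hk] at hA
        obtain ⟨d, rfl⟩ : ∃ d, k = d + 1 := ⟨k - 1, by omega⟩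
        simp only [Nat.add_sub_cancel] at hA
        obtain ⟨e0, he0, h1, h2⟩ := D_row hm l d (by omega) hv' hA
        by_cases hcd : c = d
        · subst hcd
          by_cases hcm : c + 1 = m
          · obtain rfl : c = m - 1 := by omega
            rw [row_m hm (.neg _) hcm, weight_blk _ _ he0 h1]
            split_ifs
            · exact wt _ rfl
            · exact Or.inl rfl
          · rw [row_neg_low (by omega), Matrix.add_mul, Matrix.add_mul, weight_blk _ _ he0 h1]
            split_ifs with h
            · subst h
              rw [h2 (c + 1) (by omega) (by omega), add_zero]
              exact wt _ rfl
            · rw [zero_add]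
              exact ih' _ (by omega)
        · obtain rfl : c = d + 1 := by omega
          rw [row_neg_up (by omega)]
          exact ih' _ (by omega)

/-- before the next occurrence of `x`, its successor occurs -/
def Fol (x : SIdx) : List SIdx → Prop
  | [] => True
  | y :: l => y = x.succ ∨ (y ≠ x ∧ Fol x l)

/-- recursive form of the SIP -/
def Sp : List SIdx → Prop
  | [] => True
  | x :: l => Fol x l ∧ Sp l

lemma succ_ne (x : SIdx) : x.succ ≠ x := by
  cases x with
  | pos k => simp [SIdx.succ]
  | neg k => cases k <;> simp [SIdx.succ]

lemma fol_of (x : SIdx) (l : List SIdx)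
    (h : ∀ b : ℕ, l[b]? = some x → ∃ c < b, l[c]? = some x.succ) : Fol x l := by
  induction l with
  | nil => trivial
  | cons y l ih =>
    by_cases hy : y = x.succ
    · exact Or.inl hy
    · refine Or.inr ⟨?_, ih ?_⟩
      · rintro rfl
        obtain ⟨c, hc, -⟩ := h 0 (by simp)
        omega
      · intro b hb
        obtain ⟨c, hc, h2⟩ := h (b + 1) (by simpa using hb)
        cases c with
        | zero => simp at h2; exact absurd h2 hy
        | succ c => exact ⟨c, by omega, by simpa using h2⟩

lemma sp_of (l : List SIdx)
    (h : ∀ (a b : ℕ) (x : SIdx), a < b → l[a]? = some x → l[b]? = some x →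
      ∃ c : ℕ, a < c ∧ c < b ∧ l[c]? = some x.succ) : Sp l := by
  induction l with
  | nil => trivial
  | cons y l ih =>
    refine ⟨fol_of _ _ ?_, ih ?_⟩
    · intro b hb
      obtain ⟨c, h1, h2, h3⟩ := h 0 (b + 1) y (by omega) (by simp) (by simpa using hb)
      obtain ⟨d, rfl⟩ : ∃ d, c = d + 1 := ⟨c - 1, by omega⟩
      exact ⟨d, by omega, by simpa using h3⟩
    · intro a b x hab ha hb
      obtain ⟨c, h1, h2, h3⟩ := h (a + 1) (b + 1) x (by omega) (by simpa using ha)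
        (by simpa using hb)
      obtain ⟨d, rfl⟩ : ∃ d, c = d + 1 := ⟨c - 1, by omega⟩
      exact ⟨d, by omega, by omega, by simpa using h3⟩

lemma SIP.sp {l : List SIdx} (h : SIP l) : Sp l := by
  apply sp_of
  intro a b x hab ha hb
  obtain ⟨ha', ha⟩ := List.getElem?_eq_some_iff.1 ha
  obtain ⟨hb', hb⟩ := List.getElem?_eq_some_iff.1 hb
  obtain ⟨c, h1, h2, h3⟩ := h ⟨a, ha'⟩ ⟨b, hb'⟩ hab (by simp [ha, hb])
  refine ⟨c, h1, h2, ?_⟩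
  rw [List.getElem?_eq_some_iff]
  exact ⟨c.2, by simpa [ha] using h3⟩

lemma sp_right {a b : List SIdx} (h : Sp (a ++ b)) : Sp b := by
  induction a with
  | nil => exact h
  | cons y a ih => exact ih h.2

lemma fol_mem {x : SIdx} {a b : List SIdx} (h : Fol x (a ++ x :: b)) : x.succ ∈ a := by
  induction a with
  | nil =>
    rcases h with h | h
    · exact absurd h.symm (succ_ne x)
    · exact absurd rfl h.1
  | cons y a ih =>
    rcases h with h | h
    · simp [h]
    · exact List.mem_cons_of_mem _ (ih h.2)

lemma fol_right {x : SIdx} {a b : List SIdx} (h : Fol x (a ++ b)) (hx : x.succ ∉ a) :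
    Fol x b := by
  induction a with
  | nil => exact h
  | cons y a ih =>
    simp only [List.mem_cons, not_or] at hx
    rcases h with h | h
    · exact absurd h.symm hx.1
    · exact ih h.2 hx.2

lemma fol_notMem {x : SIdx} {l : List SIdx} (h : x ∉ l) : Fol x l := by
  induction l with
  | nil => trivial
  | cons y l ih =>
    simp only [List.mem_cons, not_or] at h
    exact Or.inr ⟨fun e => h.1 e.symm, ih h.2⟩

lemma midF {x : SIdx} {s s2 : List SIdx} (hS : Sp (s ++ s2)) (hx : x ∈ s) (hn : s.Nodup)
    (hF : Fol x (s ++ s2)) : x.succ ∈ s ∧ Fol x s2 := by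
  obtain ⟨a, b, rfl⟩ := List.append_of_mem hx
  simp only [List.append_assoc, List.cons_append] at hS hF
  have h1 := fol_mem hF
  refine ⟨by simp [h1], ?_⟩
  have h2 := (sp_right hS).1
  refine fol_right h2 fun hb => ?_
  have := (List.nodup_append.1 hn).2.2 _ h1 _ (List.mem_cons_of_mem _ hb)
  exact this rfl

lemma right_succ {x : SIdx} {s s2 : List SIdx} (hS : Sp (s ++ s2)) (hsub : ∀ y ∈ s2, y ∈ s)
    (hx : x ∈ s2) : x.succ ∈ s := by
  obtain ⟨a, b, rfl⟩ := List.append_of_mem (hsub x hx)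
  obtain ⟨c, d, rfl⟩ := List.append_of_mem hx
  simp only [List.append_assoc, List.cons_append] at hS
  have h2 := (sp_right hS).1
  rw [← List.append_assoc] at h2
  have h3 := fol_mem h2
  rcases List.mem_append.1 h3 with h | h
  · simp [h]
  · exact hsub _ (by simp [h])

lemma runU {m : ℕ} (s r t : List SIdx) : ∀ k, (∀ y ∈ s, ∃ i, y = SIdx.pos i) →
    (SIdx.pos m ∈ s → k + 1 ≠ m ∧ SIdx.pos (m - 1) ∉ s) → Fol (.pos k) (s ++ r) → Sp (s ++ r) →
    (∀ j, (j = k ∨ SIdx.pos j ∈ s) → Fol (.pos j) r → UM m t j) → UM m (s ++ t) k := by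
  induction s with
  | nil => intro k _ _ hF _ ht; exact ht k (Or.inl rfl) hF
  | cons y s ih =>
    intro k hp hm hF hS ht
    obtain ⟨i, rfl⟩ := hp y (by simp)
    have hp' : ∀ y ∈ s, ∃ i, y = SIdx.pos i := fun y hy => hp y (by simp [hy])
    by_cases hi : i = k + 1
    · subst hi
      simp only [List.cons_append, UM]
      refine ⟨by omega, ?_⟩
      rw [if_pos trivial]
      refine ⟨fun h => (hm (by simp [h])).1 h, ?_⟩
      refine ih _ hp' ?_ hS.1 hS.2 ?_
      · intro h
        have := hm (by simp [h])
        refine ⟨fun h2 => this.2 ?_, fun h2 => this.2 (by simp [h2])⟩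
        have : m - 1 = k + 1 := by omega
        simp [this]
      · intro j hj hjr
        refine ht j (Or.inr ?_) hjr
        rcases hj with rfl | hj
        · simp
        · simp [hj]
    · simp only [List.cons_append, Fol, SIdx.succ, SIdx.pos.injEq, hi, false_or, ne_eq] at hF
      simp only [List.cons_append, UM]
      refine ⟨fun h => hF.1 h.symm, ?_⟩
      rw [if_neg (fun h => hi h.symm)]
      refine ih _ hp' ?_ hF.2 hS.2 ?_
      · intro h
        have := hm (by simp [h])
        exact ⟨this.1, fun h2 => this.2 (by simp [h2])⟩
      · intro j hj hjr
        refine ht j ?_ hjr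
        rcases hj with rfl | hj
        · simp
        · simp [hj]

lemma runD {m : ℕ} (s r t : List SIdx) : ∀ k, 1 ≤ k → (∀ y ∈ s, ∃ i, y = SIdx.neg i) →
    (SIdx.neg 0 ∈ s → k ≠ 1 ∧ SIdx.neg 1 ∉ s) → Fol (.neg k) (s ++ r) → Sp (s ++ r) →
    (∀ j, 1 ≤ j → (j = k ∨ SIdx.neg j ∈ s) → Fol (.neg j) r → DM m t (j - 1)) →
    DM m (s ++ t) (k - 1) := by
  induction s with
  | nil => intro k hk _ _ hF _ ht; exact ht k hk (Or.inl rfl) hF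
  | cons y s ih =>
    intro k hk hp hm hF hS ht
    obtain ⟨i, rfl⟩ := hp y (by simp)
    have hp' : ∀ y ∈ s, ∃ i, y = SIdx.neg i := fun y hy => hp y (by simp [hy])
    obtain ⟨d, rfl⟩ : ∃ d, k = d + 1 := ⟨k - 1, by omega⟩
    by_cases hi : i = d
    · subst hi
      simp only [List.cons_append, DM]
      refine ⟨by omega, ?_⟩
      rw [if_pos (by omega)]
      have hi0 : i ≠ 0 := fun h => (hm (by simp [h])).1 (by omega)
      refine ⟨hi0, ?_⟩
      refine ih _ (by omega) hp' ?_ hS.1 hS.2 ?_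
      · intro h
        have := hm (by simp [h])
        refine ⟨fun h2 => this.2 (by simp [h2]), fun h2 => this.2 (by simp [h2])⟩
      · intro j hj1 hj hjr
        refine ht j hj1 (Or.inr ?_) hjr
        rcases hj with rfl | hj
        · simp
        · simp [hj]
    · simp only [List.cons_append, Fol, SIdx.succ, SIdx.neg.injEq, hi, false_or, ne_eq] at hF
      simp only [List.cons_append, DM]
      refine ⟨by omega, ?_⟩
      rw [if_neg (by omega)]
      refine ih _ hk hp' ?_ hF.2 hS.2 ?_
      · intro h
        have := hm (by simp [h])
        exact ⟨this.1, fun h2 => this.2 (by simp [h2])⟩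
      · intro j hj1 hj hjr
        refine ht j hj1 ?_ hjr
        rcases hj with rfl | hj
        · simp
        · simp [hj]

lemma skipU {m j : ℕ} (s t : List SIdx)
    (h : ∀ y ∈ s, ∃ i, y = SIdx.neg i ∧ i ≠ j ∧ i ≠ j + 1) (ht : UM m t j) :
    UM m (s ++ t) j := by
  induction s with
  | nil => exact ht
  | cons y s ih =>
    obtain ⟨i, rfl, h1, h2⟩ := h y (by simp)
    exact ⟨h1.symm, h2.symm, ih fun y hy => h y (by simp [hy])⟩

lemma skipD {m c : ℕ} (s t : List SIdx)
    (h : ∀ y ∈ s, ∃ i, y = SIdx.pos i ∧ i ≠ c ∧ i ≠ c + 1) (ht : DM m t c) :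
    DM m (s ++ t) c := by
  induction s with
  | nil => exact ht
  | cons y s ih =>
    obtain ⟨i, rfl, h1, h2⟩ := h y (by simp)
    exact ⟨h1.symm, h2.symm, ih fun y hy => h y (by simp [hy])⟩

lemma allGood_append {m : ℕ} (a b : List SIdx)
    (h : ∀ a0 x a1, a = a0 ++ x :: a1 → After m x (a1 ++ b)) (hb : AllGood m b) :
    AllGood m (a ++ b) := by
  induction a with
  | nil => exact hb
  | cons y a ih =>
    exact ⟨h [] y a rfl, ih fun a0 x a1 e => h (y :: a0) x a1 (by simp [e])⟩

section ctx
variable {m n : ℕ} (E : EGFPData m n)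

lemma val_le_of_sig {y : SIdx} (h : y ∈ E.sig) : y.val ≤ m := by
  have : y.val ∈ List.range (m + 1) :=
    E.hperm.mem_iff.1 (List.mem_append_left _ (List.mem_map_of_mem h))
  simp at this; omega

lemma val_le_of_tau {y : SIdx} (h : y ∈ E.tau) : y.val ≤ m := by
  have : y.val ∈ List.range (m + 1) :=
    E.hperm.mem_iff.1 (List.mem_append_right _ (List.mem_map_of_mem h))
  simp at this; omega

lemma sig_pos {y : SIdx} (h : y ∈ E.sig) : ∃ i, y = SIdx.pos i := by
  have := E.hsigpos y h
  cases y with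
  | pos k => exact ⟨k, rfl⟩
  | neg k => simp [SIdx.isNeg] at this

lemma tau_neg {y : SIdx} (h : y ∈ E.tau) : ∃ i, y = SIdx.neg i := by
  have := E.htauneg y h
  cases y with
  | neg k => exact ⟨k, rfl⟩
  | pos k => simp [SIdx.isNeg] at this

lemma nodup_all : (E.sig.map SIdx.val ++ E.tau.map SIdx.val).Nodup :=
  E.hperm.nodup_iff.2 List.nodup_range

lemma sig_nodup : E.sig.Nodup := (List.nodup_append.1 (nodup_all E)).1.of_map _

lemma tau_nodup : E.tau.Nodup := (List.nodup_append.1 (nodup_all E)).2.1.of_map _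

lemma disj {k : ℕ} (h1 : SIdx.pos k ∈ E.sig) (h2 : SIdx.neg k ∈ E.tau) : False :=
  (List.nodup_append.1 (nodup_all E)).2.2 k (List.mem_map_of_mem (f := SIdx.val) h1) k
    (List.mem_map_of_mem (f := SIdx.val) h2) rfl

lemma sp_sig : Sp (E.sig1 ++ (E.sig ++ E.sig2)) := by
  rw [← List.append_assoc]; exact SIP.sp E.hSIPsig

lemma sp_tau : Sp (E.tau1 ++ (E.tau ++ E.tau2)) := by
  rw [← List.append_assoc]; exact SIP.sp E.hSIPtau

lemma succ_sig2 {i : ℕ} (h : SIdx.pos i ∈ E.sig2) : SIdx.pos (i + 1) ∈ E.sig :=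
  right_succ (sp_right (sp_sig E)) (fun y hy => (E.hsig2 y hy).1) h

lemma succ_tau2 {i : ℕ} (h : SIdx.neg (i + 1) ∈ E.tau2) : SIdx.neg i ∈ E.tau :=
  right_succ (sp_right (sp_tau E)) (fun y hy => (E.htau2 y hy).1) h

lemma U_tau2 {j : ℕ} (h : SIdx.pos j ∈ E.sig) : UM m E.tau2 j := by
  rw [← List.append_nil E.tau2]
  refine skipU _ _ (fun y hy => ?_) trivial
  obtain ⟨i, rfl⟩ := tau_neg E (E.htau2 y hy).1
  refine ⟨i, rfl, ?_, ?_⟩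
  · rintro rfl
    exact disj E h (E.htau2 _ hy).1
  · rintro rfl
    exact disj E h (succ_tau2 E hy)

lemma U_tau2_zero : UM m E.tau2 0 := by
  rw [← List.append_nil E.tau2]
  refine skipU _ _ (fun y hy => ?_) trivial
  obtain ⟨i, rfl⟩ := tau_neg E (E.htau2 y hy).1
  have := (E.htau2 _ hy).2
  simp only [SIdx.val] at this
  exact ⟨i, rfl, by omega, by omega⟩

lemma U_run_sig2 {k : ℕ} (hk : SIdx.pos k ∈ E.sig ∨ k = 0) (hF : Fol (.pos k) E.sig2) :
    UM m (E.sig2 ++ E.tau2) k := by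
  refine runU (m := m) E.sig2 [] E.tau2 k (fun y hy => sig_pos E (E.hsig2 y hy).1) ?_ (by simpa)
    (by simpa using sp_right (sp_right (sp_sig E))) ?_
  · intro h
    have := (E.hsig2 _ h).2
    simp [SIdx.val] at this
  · rintro j (rfl | hj) -
    · rcases hk with hk | rfl
      · exact U_tau2 E hk
      · exact U_tau2_zero E
    · exact U_tau2 E (E.hsig2 _ hj).1

lemma D_tau2 {k : ℕ} (hk : 1 ≤ k) (hF : Fol (.neg k) E.tau2) : DM m E.tau2 (k - 1) := by
  rw [← List.append_nil E.tau2]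
  refine runD E.tau2 [] [] k hk (fun y hy => tau_neg E (E.htau2 y hy).1) ?_ (by simpa)
    (by simpa using sp_right (sp_right (sp_tau E))) (fun _ _ _ _ => trivial)
  intro h
  have := (E.htau2 _ h).2
  simp [SIdx.val] at this

lemma D_sig2tau2 {j : ℕ} (hj : SIdx.neg j ∈ E.tau) (h1 : 1 ≤ j) (hF : Fol (.neg j) E.tau2) :
    DM m (E.sig2 ++ E.tau2) (j - 1) := by
  refine skipD _ _ (fun y hy => ?_) (D_tau2 E h1 hF)
  obtain ⟨i, rfl⟩ := sig_pos E (E.hsig2 y hy).1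
  refine ⟨i, rfl, fun h => ?_, fun h => ?_⟩
  · have h2 := succ_sig2 E hy
    rw [show i + 1 = j by omega] at h2
    exact disj E h2 hj
  · have h2 := (E.hsig2 _ hy).1
    rw [show i = j by omega] at h2
    exact disj E h2 hj

lemma good_tau2 : AllGood m E.tau2 := by
  rw [← List.append_nil E.tau2]
  refine allGood_append _ _ (fun a0 x a1 e => ?_) trivial
  have hx : x ∈ E.tau2 := by simp [e]
  have hsub : ∀ y ∈ a1, y ∈ E.tau2 := fun y hy => by simp [e, hy]
  obtain ⟨k, rfl⟩ := tau_neg E (E.htau2 x hx).1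
  have hk := (E.htau2 _ hx).2
  simp only [SIdx.val] at hk
  simp only [After]
  rw [if_neg (by omega)]
  have hS : Sp (SIdx.neg k :: a1) := by
    have := sp_right (sp_right (sp_tau E))
    rw [e] at this
    exact sp_right this
  refine runD a1 [] [] k (by omega) (fun y hy => tau_neg E (E.htau2 y (hsub y hy)).1) ?_
    (by simpa using hS.1) (by simpa using hS.2) (fun _ _ _ _ => trivial)
  intro h
  have := (E.htau2 _ (hsub _ h)).2
  simp [SIdx.val] at this

lemma good_sig2 : AllGood m (E.sig2 ++ E.tau2) := by
  refine allGood_append _ _ (fun a0 x a1 e => ?_) (good_tau2 E)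
  have hx : x ∈ E.sig2 := by simp [e]
  have hsub : ∀ y ∈ a1, y ∈ E.sig2 := fun y hy => by simp [e, hy]
  obtain ⟨k, rfl⟩ := sig_pos E (E.hsig2 x hx).1
  have hk := (E.hsig2 _ hx).2
  simp only [SIdx.val] at hk
  simp only [After]
  rw [if_neg (by omega)]
  have hS : Sp (SIdx.pos k :: a1) := by
    have := sp_right (sp_right (sp_sig E))
    rw [e] at this
    exact sp_right this
  refine runU a1 [] _ k (fun y hy => sig_pos E (E.hsig2 y (hsub y hy)).1) ?_
    (by simpa using hS.1) (by simpa using hS.2) ?_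
  · intro h
    have := (E.hsig2 _ (hsub _ h)).2
    simp [SIdx.val] at this
  · rintro j (rfl | hj) -
    · exact U_tau2 E (E.hsig2 _ hx).1
    · exact U_tau2 E (E.hsig2 _ (hsub _ hj)).1

/-- skipping a block of positive indices in downward mode -/
lemma skipD_sig {j : ℕ} (s t : List SIdx) (hs : ∀ y ∈ s, y ∈ E.sig) (h1 : 1 ≤ j)
    (hj : SIdx.neg j ∈ E.tau) (hj' : SIdx.neg (j - 1) ∈ E.tau) (ht : DM m t (j - 1)) :
    DM m (s ++ t) (j - 1) := by
  refine skipD _ _ (fun y hy => ?_) ht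
  obtain ⟨i, rfl⟩ := sig_pos E (hs y hy)
  refine ⟨i, rfl, fun h => ?_, fun h => ?_⟩
  · have h2 := hs _ hy
    rw [h] at h2
    exact disj E h2 hj'
  · have h2 := hs _ hy
    rw [show i = j by omega] at h2
    exact disj E h2 hj

/-- the middle part after a run in `τ₁` -/
lemma after_tau1 {k : ℕ} {a0 a1 t : List SIdx} (e : E.tau1 = a0 ++ SIdx.neg k :: a1)
    (ht : ∀ j, 1 ≤ j → SIdx.neg j ∈ E.tau → SIdx.neg (j - 1) ∈ E.tau →
      Fol (.neg j) (E.tau ++ E.tau2) → Fol (.neg j) E.tau2 → DM m t (j - 1)) :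
    After m (.neg k) (a1 ++ t) := by
  have hx : SIdx.neg k ∈ E.tau1 := by simp [e]
  have hsub : ∀ y ∈ a1, y ∈ E.tau1 := fun y hy => by simp [e, hy]
  have hk := (E.htau1 _ hx).2
  simp only [SIdx.val] at hk
  simp only [After]
  rw [if_neg (by omega)]
  have hS : Sp (SIdx.neg k :: (a1 ++ (E.tau ++ E.tau2))) := by
    have := sp_tau E
    rw [e] at this
    simp only [List.append_assoc, List.cons_append] at this
    exact sp_right this
  refine runD a1 (E.tau ++ E.tau2) _ k (by omega)
    (fun y hy => tau_neg E (E.htau1 y (hsub y hy)).1) ?_ hS.1 hS.2 ?_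
  · intro h
    have := (E.htau1 _ (hsub _ h)).2
    simp [SIdx.val] at this
  · intro j hj1 hj hF
    have hjt : SIdx.neg j ∈ E.tau := by
      rcases hj with rfl | hj
      · exact (E.htau1 _ hx).1
      · exact (E.htau1 _ (hsub _ hj)).1
    obtain ⟨h1, h2⟩ := midF (sp_right (sp_tau E)) hjt (tau_nodup E) hF
    obtain ⟨d, rfl⟩ : ∃ d, j = d + 1 := ⟨j - 1, by omega⟩
    exact ht _ hj1 hjt h1 hF h2

lemma good_L0 (hsig : ¬ (SIdx.pos (m - 1) ∈ E.sig ∧ SIdx.pos m ∈ E.sig)) :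
    AllGood m (E.tau1 ++ ((E.sig1 ++ (E.sig ++ E.sig2)) ++ E.tau2)) := by
  have hall : ∀ y ∈ E.sig1 ++ (E.sig ++ E.sig2), y ∈ E.sig := by
    intro y hy
    simp only [List.mem_append] at hy
    rcases hy with hy | hy | hy
    · exact (E.hsig1 y hy).1
    · exact hy
    · exact (E.hsig2 y hy).1
  refine allGood_append _ _ (fun a0 x a1 e => ?_) (allGood_append _ _ (fun a0 x a1 e => ?_)
    (good_tau2 E))
  · have hx : x ∈ E.tau1 := by simp [e]
    obtain ⟨k, rfl⟩ := tau_neg E (E.htau1 x hx).1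
    refine after_tau1 E e fun j h1 hj hj' _ hF => ?_
    exact skipD_sig E _ _ hall h1 hj hj' (D_tau2 E h1 hF)
  · have hx := hall x (by simp [e])
    have hsub : ∀ y ∈ a1, y ∈ E.sig := fun y hy => hall y (by simp [e, hy])
    obtain ⟨k, rfl⟩ := sig_pos E hx
    simp only [After]
    have hS : Sp (SIdx.pos k :: a1) := by
      have := sp_sig E
      rw [e] at this
      exact sp_right this
    have hm := E.hm
    split_ifs with hkm
    · subst hkm
      refine skipD _ _ (fun y hy => ?_) (D_tau2 E (by omega) (fol_notMem fun h => ?_))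
      · have hy' := hsub y hy
        obtain ⟨i, rfl⟩ := sig_pos E hy'
        refine ⟨i, rfl, ?_, ?_⟩
        · rintro rfl
          exact hsig ⟨hy', hx⟩
        · intro h
          rw [show i = k by omega] at hy hy' 
          obtain ⟨c, d, rfl⟩ := List.append_of_mem hy
          have h3 := fol_mem hS.1
          have := val_le_of_sig E (hsub (SIdx.pos (k + 1)) (by
            simp only [SIdx.succ] at h3; simp [h3]))
          simp [SIdx.val] at this
      · exact disj E hx (E.htau2 _ h).1
    · refine runU a1 [] _ k (fun y hy => sig_pos E (hsub y hy)) ?_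
        (by simpa using hS.1) (by simpa using hS.2) ?_
      · intro h
        refine ⟨fun h2 => hsig ⟨?_, hsub _ h⟩, fun h2 => hsig ⟨hsub _ h2, hsub _ h⟩⟩
        rwa [show m - 1 = k by omega]
      · rintro j (rfl | hj) -
        · exact U_tau2 E hx
        · exact U_tau2 E (hsub _ hj)

lemma run_tau (htau : ¬ (SIdx.neg 1 ∈ E.tau ∧ SIdx.neg 0 ∈ E.tau)) {k : ℕ} (hk : 1 ≤ k)
    (a1 : List SIdx) (hsub : ∀ y ∈ a1, y ∈ E.tau) (hx : SIdx.neg k ∈ E.tau)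
    (hF : Fol (.neg k) (a1 ++ E.tau2)) (hS : Sp (a1 ++ E.tau2)) :
    DM m (a1 ++ (E.sig2 ++ E.tau2)) (k - 1) := by
  refine runD a1 E.tau2 _ k hk (fun y hy => tau_neg E (hsub y hy)) ?_ hF hS ?_
  · intro h
    refine ⟨fun h2 => htau ⟨h2 ▸ hx, hsub _ h⟩, fun h2 => htau ⟨hsub _ h2, hsub _ h⟩⟩
  · rintro j hj1 hj hF
    refine D_sig2tau2 E ?_ hj1 hF
    rcases hj with rfl | hj
    · exact hx
    · exact hsub _ hj

lemma good_L1 (htau : ¬ (SIdx.neg 1 ∈ E.tau ∧ SIdx.neg 0 ∈ E.tau)) :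
    AllGood m (E.tau1 ++ (E.sig1 ++ (E.tau ++ (E.sig2 ++ E.tau2)))) := by
  refine allGood_append _ _ (fun a0 x a1 e => ?_) (allGood_append _ _ (fun a0 x a1 e => ?_)
    (allGood_append _ _ (fun a0 x a1 e => ?_) (good_sig2 E)))
  · have hx : x ∈ E.tau1 := by simp [e]
    obtain ⟨k, rfl⟩ := tau_neg E (E.htau1 x hx).1
    refine after_tau1 E e fun j h1 hj hj' hF _ => ?_
    refine skipD_sig E _ _ (fun y hy => (E.hsig1 y hy).1) h1 hj hj' ?_
    exact run_tau E htau h1 E.tau (fun y hy => hy) hj hF (sp_right (sp_tau E))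
  · have hx : x ∈ E.sig1 := by simp [e]
    have hsub : ∀ y ∈ a1, y ∈ E.sig1 := fun y hy => by simp [e, hy]
    obtain ⟨k, rfl⟩ := sig_pos E (E.hsig1 x hx).1
    have hk := (E.hsig1 _ hx).2
    simp only [SIdx.val] at hk
    simp only [After]
    rw [if_neg (by omega)]
    have hS : Sp (SIdx.pos k :: (a1 ++ (E.sig ++ E.sig2))) := by
      have := sp_sig E
      rw [e] at this
      simp only [List.append_assoc, List.cons_append] at this
      exact sp_right this
    refine runU a1 (E.sig ++ E.sig2) _ k
      (fun y hy => sig_pos E (E.hsig1 y (hsub y hy)).1) ?_ hS.1 hS.2 ?_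
    · intro h
      have := (E.hsig1 _ (hsub _ h)).2
      simp [SIdx.val] at this
    · intro j hj hF
      have hjt : SIdx.pos j ∈ E.sig := by
        rcases hj with rfl | hj
        · exact (E.hsig1 _ hx).1
        · exact (E.hsig1 _ (hsub _ hj)).1
      obtain ⟨h1, h2⟩ := midF (sp_right (sp_sig E)) hjt (sig_nodup E) hF
      refine skipU _ _ (fun y hy => ?_) (U_run_sig2 E (Or.inl hjt) h2)
      obtain ⟨i, rfl⟩ := tau_neg E hy
      refine ⟨i, rfl, ?_, ?_⟩
      · rintro rfl
        exact disj E hjt hy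
      · rintro rfl
        exact disj E h1 hy
  · have hx : x ∈ E.tau := by simp [e]
    have hsub : ∀ y ∈ a1, y ∈ E.tau := fun y hy => by simp [e, hy]
    obtain ⟨k, rfl⟩ := tau_neg E hx
    have hS : Sp (SIdx.neg k :: (a1 ++ E.tau2)) := by
      have := sp_right (sp_tau E)
      rw [e] at this
      simp only [List.append_assoc, List.cons_append] at this
      exact sp_right this
    simp only [After]
    split_ifs with hk
    · subst hk
      refine skipU _ _ (fun y hy => ?_) (U_run_sig2 E (Or.inr rfl) (fol_notMem fun h => ?_))
      · have hy' := hsub y hy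
        obtain ⟨i, rfl⟩ := tau_neg E hy'
        refine ⟨i, rfl, ?_, ?_⟩
        · rintro rfl
          have := tau_nodup E
          rw [e] at this
          exact (List.nodup_cons.1 (List.nodup_append.1 this).2.1).1 hy
        · rintro rfl
          exact htau ⟨hy', hx⟩
      · exact disj E (E.hsig2 _ h).1 hx
    · exact run_tau E htau (by omega) a1 hsub hx hS.1 hS.2

/-- pairs for an assigned tuple and for Fiedler tuples -/
noncomputable def fz (t : List SIdx) : List (SIdx × Matrix (Fin n) (Fin n) ℂ) :=
  t.map fun k => (k, fiedlerX m E.A k)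

lemma P_append (a b : List (SIdx × Matrix (Fin n) (Fin n) ℂ)) :
    P m n (a ++ b) = P m n a * P m n b := by simp [P]

lemma P_fz (t : List SIdx) : P m n (fz E t) = prodFiedler m n E.A t := by
  simp [P, fz, prodFiedler, Function.comp_def]

lemma map_fst_zip {t : List SIdx} {Xs : List (Matrix (Fin n) (Fin n) ℂ)}
    (h : NonsingAssign m t Xs) : (t.zip Xs).map Prod.fst = t :=
  List.map_fst_zip h.1.le

lemma map_fst_fz (t : List SIdx) : (fz E t).map Prod.fst = t := by
  simp [fz, Function.comp_def]

lemma block_eq (M : Matrix (Fin m × Fin n) (Fin m × Fin n) ℂ) (i j : Fin m) :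
    blockOf M i j = Esel m n (m - 1 - i) * M * (Esel m n (m - 1 - j))ᵀ := by
  have hi := i.2
  have hj := j.2
  ext a b
  rw [Matrix.mul_apply, Finset.sum_eq_single (j, b)]
  · rw [Esel_mul (by omega)]
    have h1 : (j : ℕ) + (m - 1 - j) + 1 = m := by omega
    have h2 : (⟨m - 1 - (m - 1 - i), by omega⟩ : Fin m) = i := by ext; simp; omega
    simp [Esel, h1, h2, blockOf]
  · rintro ⟨q, c⟩ - hne
    have : ¬ ((q : ℕ) + (m - 1 - j) + 1 = m ∧ b = c) := by
      rintro ⟨h1, rfl⟩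
      apply hne
      ext
      · simp; omega
      · rfl
    simp [Esel, this]
  · simp

lemma opfree_fz {t : List SIdx} (ht : ∀ y ∈ t, y ∈ E.sig ∨ y ∈ E.tau)
    {y : SIdx × Matrix (Fin n) (Fin n) ℂ} (hy : y ∈ fz E t) : OpFreeBlock E y.2 := by
  simp only [fz, List.mem_map] at hy
  obtain ⟨k, hk, rfl⟩ := hy
  have hv : k.val ≤ m := (ht k hk).elim (val_le_of_sig E) (val_le_of_tau E)
  refine Or.inr (Or.inr (Or.inr (Or.inl ?_)))
  cases k with
  | pos k =>
    simp only [fiedlerX]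
    split_ifs with h
    · exact ⟨m, le_rfl, by simp⟩
    · exact ⟨k, hv, by simp⟩
  | neg k =>
    simp only [fiedlerX]
    split_ifs with h
    · subst h
      have hu : IsUnit (E.A 0) := by
        rcases ht _ hk with h | h
        · obtain ⟨i, hi⟩ := sig_pos E h
          cases hi
        · exact E.hA0 h
      refine ⟨0, by omega, Or.inr (Or.inr (Or.inr ?_))⟩
      apply Matrix.inv_eq_right_inv
      rw [neg_mul_neg, Matrix.mul_nonsing_inv _ ((Matrix.isUnit_iff_isUnit_det _).1 hu)]
    · exact ⟨k, hv, by simp⟩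

lemma opfree_zip {t : List SIdx} {Xs : List (Matrix (Fin n) (Fin n) ℂ)}
    (hX : ∀ W ∈ Xs, W ∈ E.X1 ++ E.X2 ++ E.Y1 ++ E.Y2)
    {y : SIdx × Matrix (Fin n) (Fin n) ℂ} (hy : y ∈ t.zip Xs) : OpFreeBlock E y.2 :=
  Or.inr (Or.inr (Or.inr (Or.inr ⟨y.2, hX _ (List.of_mem_zip hy).2, Or.inl rfl⟩)))

lemma final {t : List SIdx} (ht : ∀ y ∈ t, y ∈ E.sig ∨ y ∈ E.tau)
    (hG : AllGood m (E.tau1 ++ (E.sig1 ++ (t ++ (E.sig2 ++ E.tau2))))) (i j : Fin m) :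
    OpFreeBlock E (blockOf (E.leftFac * prodFiedler m n E.A t * E.rightFac) i j) := by
  have hi := i.2
  have hj := j.2
  set l := E.tau1.zip E.Y1 ++ (E.sig1.zip E.X1 ++ (fz E t ++ (E.sig2.zip E.X2 ++ E.tau2.zip E.Y2)))
    with hl
  have hP : E.leftFac * prodFiedler m n E.A t * E.rightFac = P m n l := by
    rw [hl]
    simp only [P_append, P_fz, EGFPData.leftFac, EGFPData.rightFac, Matrix.mul_assoc]
    rfl
  have hfst : l.map Prod.fst = E.tau1 ++ (E.sig1 ++ (t ++ (E.sig2 ++ E.tau2))) := by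
    rw [hl]
    simp only [List.map_append, map_fst_zip E.hX1, map_fst_zip E.hX2, map_fst_zip E.hY1,
      map_fst_zip E.hY2, map_fst_fz]
  have hv : ∀ y ∈ l, y.1.val ≤ m := by
    intro y hy
    have h1 : y.1 ∈ l.map Prod.fst := List.mem_map_of_mem hy
    rw [hfst] at h1
    simp only [List.mem_append] at h1
    rcases h1 with h | h | h | h | h
    · exact val_le_of_tau E (E.htau1 _ h).1
    · exact val_le_of_sig E (E.hsig1 _ h).1
    · exact (ht _ h).elim (val_le_of_sig E) (val_le_of_tau E)
    · exact val_le_of_sig E (E.hsig2 _ h).1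
    · exact val_le_of_tau E (E.htau2 _ h).1
  rw [hP, block_eq]
  rcases main_blk E.hm l hv (by rw [hfst]; exact hG) (m - 1 - i) (m - 1 - j) (by omega)
    (by omega) with h | h | ⟨y, hy, h⟩
  · exact Or.inl h
  · exact Or.inr (Or.inl h)
  · rw [h]
    rw [hl] at hy
    simp only [List.mem_append] at hy
    rcases hy with hy | hy | hy | hy | hy
    · exact opfree_zip E (fun W hW => by simp [hW]) hy
    · exact opfree_zip E (fun W hW => by simp [hW]) hy
    · exact opfree_fz E ht hy
    · exact opfree_zip E (fun W hW => by simp [hW]) hy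
    · exact opfree_zip E (fun W hW => by simp [hW]) hy

end ctx

end EGFPProof

/-- If `m−1` and `m` do not simultaneously belong to `σ`, and `−1` and
`−0` do not simultaneously belong to `τ`, then the EGFP `L(λ) = λ L₁ − L₀` is operation
free: every `n × n` block of `L₁` and of `L₀` is `0`, `±I_n`, `±A_j`, `±A_j⁻¹`, or
(up to sign) a matrix of the assignments `X₁, X₂, Y₁, Y₂`. -/
theorem egfp_operation_free {m n : ℕ} (E : EGFPData m n)
    (hsig : ¬ (SIdx.pos (m - 1) ∈ E.sig ∧ SIdx.pos m ∈ E.sig))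
    (htau : ¬ (SIdx.neg 1 ∈ E.tau ∧ SIdx.neg 0 ∈ E.tau)) :
    ∀ i j : Fin m,
      OpFreeBlock E (blockOf E.L1 i j) ∧ OpFreeBlock E (blockOf E.L0 i j) := by
  intro i j
  refine ⟨EGFPProof.final E (fun y hy => Or.inr hy) (EGFPProof.good_L1 E htau) i j,
    EGFPProof.final E (fun y hy => Or.inl hy) ?_ i j⟩
  have := EGFPProof.good_L0 E hsig
  simpa only [List.append_assoc] using this
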